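/- arXiv:1004.1478 — 2 statements merged into one kernel-verified Lean document; each statement's English description precedes it below -/
import Mathlib

section
/- Let p ≥ 1 and δ ∈ (0,1) with δ − 1/p > 0, and set q = 1/δ. There exists a constant C, depending only on p and δ, such that for every continuous function f : [0,1] → ℝ^d, the q-variation of f is controlled by its Besov seminorm: the supremum over all finite partitions 0 = t_0 < t_1 < ⋯ < t_N = 1 of Σ_{i=1}^N |f(t_i) − f(t_{i−1})|^q is at most C · B_{δ,p}(f; 0, 1)^{q/p}, where B_{δ,p}(f; s, t) = ∫_s^t ∫_s^t |f(u) − f(v)|^p / |u − v|^{1+δp} du dv. -/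
open Set Finset MeasureTheory
open scoped ENNReal

/-- The set of `q`-variation sums of `f : [0,1] → E` over finite partitions
`0 = t₀ < t₁ < ⋯ < t_N = 1`. -/
def varSums (q : ℝ) {E : Type*} [NormedAddCommGroup E] (f : ℝ → E) : Set ℝ :=
  {S | ∃ (N : ℕ) (t : ℕ → ℝ), t 0 = 0 ∧ t N = 1 ∧ (∀ i < N, t i < t (i + 1)) ∧
    S = ∑ i ∈ Finset.range N, ‖f (t (i + 1)) - f (t i)‖ ^ q}

/-- The Besov-type double integral
`B_{δ,p}(f; s, t) = ∫_s^t ∫_s^t ‖f u − f v‖^p / |u − v|^(1+δp) du dv`,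
valued in `ℝ≥0∞` so that it may be infinite. -/
noncomputable def besov (p δ : ℝ) {d : ℕ} (f : ℝ → EuclideanSpace ℝ (Fin d)) (s t : ℝ) : ℝ≥0∞ :=
  ∫⁻ u in Icc s t, ∫⁻ v in Icc s t,
    ENNReal.ofReal (‖f u - f v‖ ^ p / |u - v| ^ (1 + δ * p))

/-- Jensen's inequality for the distance from a point to the mean of a function. -/
theorem enorm_sub_integral_rpow_le {Ω E : Type*} [MeasurableSpace Ω] {μ : Measure Ω}
    [IsProbabilityMeasure μ] [NormedAddCommGroup E] [NormedSpace ℝ E] [CompleteSpace E]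
    {f : Ω → E} (hf : Integrable f μ) (c : E) {p : ℝ} (hp : 1 ≤ p) :
    ‖c - ∫ x, f x ∂μ‖ₑ ^ p ≤ ∫⁻ x, ‖c - f x‖ₑ ^ p ∂μ := by
  have hp0 : 0 < p := by linarith
  have h1 : c - ∫ x, f x ∂μ = ∫ x, (c - f x) ∂μ := by
    rw [integral_sub (integrable_const c) hf]
    simp
  have h2 := eLpNorm'_le_eLpNorm'_of_exponent_le (μ := μ) (f := fun x => c - f x) one_pos hp
    ((integrable_const c).sub hf).aestronglyMeasurable
  simp only [eLpNorm', ENNReal.rpow_one, div_one] at h2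
  calc ‖c - ∫ x, f x ∂μ‖ₑ ^ p
      ≤ ((∫⁻ x, ‖c - f x‖ₑ ^ p ∂μ) ^ (1 / p)) ^ p := by
        rw [h1]
        gcongr
        exact (enorm_integral_le_lintegral_enorm _).trans h2
    _ = ∫⁻ x, ‖c - f x‖ₑ ^ p ∂μ := by
        rw [← ENNReal.rpow_mul, one_div_mul_cancel hp0.ne', ENNReal.rpow_one]

theorem enorm_sub_setAverage_rpow_le {E : Type*} [NormedAddCommGroup E] [NormedSpace ℝ E]
    [CompleteSpace E] {f : ℝ → E} {a b : ℝ} (hab : a < b) (hf : ContinuousOn f (Icc a b)) (c : E)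
    {p : ℝ} (hp : 1 ≤ p) :
    ‖c - ⨍ x in Icc a b, f x‖ₑ ^ p
      ≤ (ENNReal.ofReal (b - a))⁻¹ * ∫⁻ x in Icc a b, ‖c - f x‖ₑ ^ p := by
  have h0 : volume (Icc a b) ≠ 0 := by simp [hab]
  have : NeZero (volume.restrict (Icc a b)) := ⟨by simpa [Measure.restrict_eq_zero] using h0⟩
  have : IsFiniteMeasure (volume.restrict (Icc a b)) := ⟨by simp⟩
  have h := enorm_sub_integral_rpow_le
    (μ := ((volume.restrict (Icc a b)) univ)⁻¹ • volume.restrict (Icc a b)) (f := f)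
    (Integrable.to_average hf.integrableOn_Icc) c hp
  rw [lintegral_smul_measure] at h
  simpa [average] using h

theorem enorm_setAverage_sub_setAverage_rpow_le {p δ : ℝ} (hp : 1 ≤ p) (hδ : 0 < δ) {d : ℕ}
    {f : ℝ → EuclideanSpace ℝ (Fin d)} {s t a b a' b' : ℝ} (hf : ContinuousOn f (Icc s t))
    (hsa : s ≤ a) (hbt : b ≤ t) (haa' : a ≤ a') (hb'b : b' ≤ b) (hab' : a' < b') :
    ‖(⨍ x in Icc a b, f x) - ⨍ x in Icc a' b', f x‖ₑ ^ p
      ≤ (ENNReal.ofReal (b' - a'))⁻¹ * ((ENNReal.ofReal (b - a))⁻¹ *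
          (ENNReal.ofReal ((b - a) ^ (1 + δ * p)) * besov p δ f s t)) := by
  have hp0 : 0 < p := by linarith
  have hab : a < b := by linarith
  have hsub : Icc a b ⊆ Icc s t := Set.Icc_subset_Icc hsa hbt
  have hsub' : Icc a' b' ⊆ Icc a b := Set.Icc_subset_Icc haa' hb'b
  have key : ∀ v ∈ Icc a b, ∀ u ∈ Icc a b, ‖f v - f u‖ₑ ^ p ≤ ENNReal.ofReal ((b - a) ^ (1 + δ * p))
      * ENNReal.ofReal (‖f v - f u‖ ^ p / |v - u| ^ (1 + δ * p)) := by
    intro v hv u hu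
    rw [← ofReal_norm, ENNReal.ofReal_rpow_of_nonneg (norm_nonneg _) hp0.le,
      ← ENNReal.ofReal_mul (by have := sub_pos.2 hab; positivity)]
    apply ENNReal.ofReal_le_ofReal
    rcases eq_or_ne v u with rfl | hne
    · simp [Real.zero_rpow hp0.ne']
    have hpos : 0 < |v - u| := abs_pos.2 (sub_ne_zero.2 hne)
    have hle : |v - u| ≤ b - a := by
      rw [abs_le]; constructor <;> linarith [hv.1, hv.2, hu.1, hu.2]
    rw [mul_div_assoc', le_div_iff₀ (by positivity), mul_comm]
    gcongr
  calc ‖(⨍ x in Icc a b, f x) - ⨍ x in Icc a' b', f x‖ₑ ^ p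
      ≤ (ENNReal.ofReal (b' - a'))⁻¹ *
          ∫⁻ v in Icc a' b', ‖(⨍ x in Icc a b, f x) - f v‖ₑ ^ p :=
        enorm_sub_setAverage_rpow_le hab' (hf.mono (hsub'.trans hsub)) _ hp
    _ ≤ (ENNReal.ofReal (b' - a'))⁻¹ * ∫⁻ v in Icc a' b', ((ENNReal.ofReal (b - a))⁻¹ *
          (ENNReal.ofReal ((b - a) ^ (1 + δ * p)) * ∫⁻ u in Icc s t,
            ENNReal.ofReal (‖f v - f u‖ ^ p / |v - u| ^ (1 + δ * p)))) := by
        refine mul_le_mul' le_rfl ?_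
        refine setLIntegral_mono' measurableSet_Icc fun v hv => ?_
        rw [← enorm_neg, neg_sub]
        refine (enorm_sub_setAverage_rpow_le hab (hf.mono hsub) _ hp).trans ?_
        refine mul_le_mul' le_rfl ?_
        rw [← lintegral_const_mul' _ _ ENNReal.ofReal_ne_top]
        exact (setLIntegral_mono' (measurableSet_Icc (a := a) (b := b)) (key v (hsub' hv))).trans
          (lintegral_mono_set hsub)
    _ ≤ _ := by
        rw [lintegral_const_mul' _ _ (by simp [hab]),
          lintegral_const_mul' _ _ ENNReal.ofReal_ne_top]
        gcongr
        exact lintegral_mono_set (hsub'.trans hsub)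

theorem tendsto_setAverage_of_shrinking {E : Type*} [NormedAddCommGroup E] [NormedSpace ℝ E]
    [CompleteSpace E] {f : ℝ → E} {s t x : ℝ} (hf : ContinuousOn f (Icc s t)) {a b : ℕ → ℝ}
    (hs : ∀ n, s ≤ a n) (ht : ∀ n, b n ≤ t) (hab : ∀ n, a n < b n)
    (hx : ∀ n, x ∈ Icc (a n) (b n)) (hlim : Filter.Tendsto (fun n => b n - a n) Filter.atTop
      (nhds 0)) :
    Filter.Tendsto (fun n => ⨍ y in Icc (a n) (b n), f y) Filter.atTop (nhds (f x)) := by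
  rw [Metric.tendsto_atTop]
  intro ε hε
  have hxst : x ∈ Icc s t := Set.Icc_subset_Icc (hs 0) (ht 0) (hx 0)
  obtain ⟨η, hη, hη'⟩ := Metric.continuousOn_iff.1 hf x hxst (ε / 2) (by positivity)
  obtain ⟨N, hN⟩ := Metric.tendsto_atTop.1 hlim η hη
  refine ⟨N, fun n hn => ?_⟩
  have hn' := hN n hn
  rw [Real.dist_eq, sub_zero, abs_of_pos (sub_pos.2 (hab n))] at hn'
  have hmem : (⨍ y in Icc (a n) (b n), f y) ∈ Metric.closedBall (f x) (ε / 2) := by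
    refine (convex_closedBall _ _).set_average_mem Metric.isClosed_closedBall (by simp [hab n])
      (by simp) ?_ (hf.mono (Set.Icc_subset_Icc (hs n) (ht n))).integrableOn_Icc
    refine (ae_restrict_iff' measurableSet_Icc).2 (Filter.Eventually.of_forall fun y hy => ?_)
    refine (hη' y (Set.Icc_subset_Icc (hs n) (ht n) hy) ?_).le
    rw [Real.dist_eq, abs_lt]
    constructor <;> linarith [hy.1, hy.2, (hx n).1, (hx n).2]
  exact lt_of_le_of_lt (Metric.mem_closedBall.1 hmem) (by linarith)

/-- Chaining along a halving sequence of intervals shrinking to `x`. -/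
theorem dist_setAverage_le_of_halving {p δ : ℝ} (hp : 1 ≤ p) (hδ : 0 < δ) (hα : 0 < δ - 1 / p)
    {d : ℕ} {f : ℝ → EuclideanSpace ℝ (Fin d)} {s t x : ℝ} (hst : s < t)
    (hf : ContinuousOn f (Icc s t)) (hB : besov p δ f s t ≠ ∞) {a b : ℕ → ℝ}
    (ha0 : a 0 = s) (hb0 : b 0 = t) (ha : Monotone a) (hb : Antitone b)
    (hlen : ∀ n, b n - a n = (t - s) * (1 / 2) ^ n) (hx : ∀ n, x ∈ Icc (a n) (b n)) :
    dist (⨍ y in Icc s t, f y) (f x)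
      ≤ (2 * (t - s) ^ (δ * p - 1) * (besov p δ f s t).toReal) ^ (1 / p)
        / (1 - (1 / 2) ^ (δ - 1 / p)) := by
  have hp0 : 0 < p := by linarith
  have hL : 0 < t - s := sub_pos.2 hst
  have hab : ∀ n, a n < b n := fun n => by
    have := hlen n
    have : 0 < (t - s) * (1 / 2 : ℝ) ^ n := by positivity
    linarith
  have hs : ∀ n, s ≤ a n := fun n => ha0 ▸ ha n.zero_le
  have ht : ∀ n, b n ≤ t := fun n => hb0 ▸ hb n.zero_le
  have hlim : Filter.Tendsto (fun n => b n - a n) Filter.atTop (nhds 0) := by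
    simp_rw [hlen]
    simpa using (tendsto_pow_atTop_nhds_zero_of_lt_one (by norm_num : (0 : ℝ) ≤ 1 / 2)
      (by norm_num)).const_mul (t - s)
  set β := (besov p δ f s t).toReal with hβ
  have hβ0 : 0 ≤ β := ENNReal.toReal_nonneg
  have hr1 : (1 / 2 : ℝ) ^ (δ - 1 / p) < 1 :=
    Real.rpow_lt_one (by norm_num) (by norm_num) hα
  have step : ∀ n, dist (⨍ y in Icc (a n) (b n), f y) (⨍ y in Icc (a (n + 1)) (b (n + 1)), f y)
      ≤ (2 * (t - s) ^ (δ * p - 1) * β) ^ (1 / p) * ((1 / 2) ^ (δ - 1 / p)) ^ n := by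
    intro n
    have h := enorm_setAverage_sub_setAverage_rpow_le hp hδ hf (hs n) (ht n)
      (ha n.le_succ) (hb n.le_succ) (hab (n + 1))
    have hl : 0 < b n - a n := sub_pos.2 (hab n)
    have hl' : b (n + 1) - a (n + 1) = (b n - a n) / 2 := by
      rw [hlen, hlen]; ring
    rw [← ENNReal.ofReal_toReal hB, hl', ← ENNReal.ofReal_inv_of_pos (by positivity),
      ← ENNReal.ofReal_inv_of_pos hl, ← ENNReal.ofReal_mul (by positivity),
      ← ENNReal.ofReal_mul (by positivity), ← ENNReal.ofReal_mul (by positivity),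
      ← ofReal_norm, ENNReal.ofReal_rpow_of_nonneg (norm_nonneg _) hp0.le,
      ENNReal.ofReal_le_ofReal_iff (by positivity), ← hβ, ← dist_eq_norm] at h
    have e1 : ((b n - a n) / 2)⁻¹ * ((b n - a n)⁻¹ * ((b n - a n) ^ (1 + δ * p) * β))
        = 2 * (t - s) ^ (δ * p - 1) * β * (((1 / 2) ^ (δ - 1 / p)) ^ n) ^ p := by
      have e2 : (b n - a n) ^ (1 + δ * p) = (b n - a n) ^ (δ * p - 1) * (b n - a n) ^ 2 := by
        rw [← Real.rpow_natCast, ← Real.rpow_add hl]; congr 1; push_cast; ring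
      have e3 : (b n - a n) ^ (δ * p - 1)
          = (t - s) ^ (δ * p - 1) * (((1 / 2 : ℝ) ^ (δ - 1 / p)) ^ n) ^ p := by
        rw [hlen, Real.mul_rpow hL.le (by positivity), ← Real.rpow_natCast, ← Real.rpow_natCast,
          ← Real.rpow_mul (by positivity), ← Real.rpow_mul (by positivity),
          ← Real.rpow_mul (by positivity)]
        congr 2
        field_simp
      rw [e2, e3]
      field_simp
    rw [e1] at h
    have h' := Real.rpow_le_rpow (by positivity) h (by positivity : 0 ≤ 1 / p)
    rwa [Real.mul_rpow (by positivity) (by positivity), ← Real.rpow_mul dist_nonneg,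
      ← Real.rpow_mul (by positivity), mul_one_div_cancel hp0.ne', Real.rpow_one,
      Real.rpow_one] at h'
  have := dist_le_of_le_geometric_of_tendsto₀ _ _ hr1 step
    (tendsto_setAverage_of_shrinking hf hs ht hab hx hlim)
  rwa [ha0, hb0] at this

/-- Increments of a continuous function are controlled by its Besov integral. -/
theorem norm_sub_le_besov {p δ : ℝ} (hp : 1 ≤ p) (hδ : 0 < δ) (hα : 0 < δ - 1 / p)
    {d : ℕ} {f : ℝ → EuclideanSpace ℝ (Fin d)} {s t : ℝ} (hst : s < t)
    (hf : ContinuousOn f (Icc s t)) (hB : besov p δ f s t ≠ ∞) :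
    ‖f t - f s‖ ≤ 2 / (1 - (1 / 2) ^ (δ - 1 / p)) *
      (2 * (t - s) ^ (δ * p - 1) * (besov p δ f s t).toReal) ^ (1 / p) := by
  have hL : 0 < t - s := sub_pos.2 hst
  have hanti : Antitone fun n : ℕ => (t - s) * (1 / 2 : ℝ) ^ n := fun m n hmn =>
    mul_le_mul_of_nonneg_left (pow_le_pow_of_le_one (by norm_num) (by norm_num) hmn) hL.le
  have hpos : ∀ n : ℕ, 0 < (t - s) * (1 / 2 : ℝ) ^ n := fun n => by positivity
  have hleft := dist_setAverage_le_of_halving (x := s) hp hδ hα hst hf hB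
    (a := fun _ => s) (b := fun n => s + (t - s) * (1 / 2) ^ n) rfl (by simp) monotone_const
    (fun m n hmn => by have := hanti hmn; simp only at this ⊢; linarith) (fun n => by ring)
    (fun n => ⟨le_rfl, by have := hpos n; linarith⟩)
  have hright := dist_setAverage_le_of_halving (x := t) hp hδ hα hst hf hB
    (a := fun n => t - (t - s) * (1 / 2) ^ n) (b := fun _ => t) (by simp) rfl
    (fun m n hmn => by have := hanti hmn; simp only at this ⊢; linarith) antitone_const
    (fun n => by ring) (fun n => ⟨by have := hpos n; linarith, le_rfl⟩)
  rw [← dist_eq_norm]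
  calc dist (f t) (f s)
      ≤ dist (⨍ y in Icc s t, f y) (f t) + dist (⨍ y in Icc s t, f y) (f s) :=
        dist_triangle_left _ _ _
    _ ≤ _ := add_le_add hright hleft
    _ = _ := by ring

theorem sum_besov_le {p δ : ℝ} {d : ℕ} (f : ℝ → EuclideanSpace ℝ (Fin d)) {t : ℕ → ℝ} {N : ℕ}
    (ht : ∀ i < N, t i ≤ t (i + 1)) :
    ∑ i ∈ Finset.range N, besov p δ f (t i) (t (i + 1)) ≤ besov p δ f (t 0) (t N) := by
  have hmono : ∀ i ≤ N, ∀ j ≤ i, t j ≤ t i := by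
    intro i hi j hj
    induction i, hj using Nat.le_induction with
    | base => exact le_rfl
    | succ i hij ih => exact (ih (by omega)).trans (ht i (by omega))
  set g : ℝ → ℝ≥0∞ := fun u => ∫⁻ v in Icc (t 0) (t N),
    ENNReal.ofReal (‖f u - f v‖ ^ p / |u - v| ^ (1 + δ * p)) with hg
  have hsum : ∀ n ≤ N, ∑ i ∈ Finset.range n, ∫⁻ u in Ioc (t i) (t (i + 1)), g u
      = ∫⁻ u in Ioc (t 0) (t n), g u := by
    intro n hn
    induction n with
    | zero => simp
    | succ n ih =>
      rw [Finset.sum_range_succ, ih (by omega),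
        ← lintegral_union measurableSet_Ioc (Set.Ioc_disjoint_Ioc_of_le le_rfl),
        Set.Ioc_union_Ioc_eq_Ioc (hmono n (by omega) 0 n.zero_le) (ht n (by omega))]
  calc ∑ i ∈ Finset.range N, besov p δ f (t i) (t (i + 1))
      ≤ ∑ i ∈ Finset.range N, ∫⁻ u in Ioc (t i) (t (i + 1)), g u := by
        refine Finset.sum_le_sum fun i hi => ?_
        have hi := Finset.mem_range.1 hi
        rw [besov, ← restrict_Ioc_eq_restrict_Icc (μ := volume) (a := t i), hg]
        refine lintegral_mono fun u => ?_
        rw [restrict_Ioc_eq_restrict_Icc]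
        exact lintegral_mono_set
          (Set.Icc_subset_Icc (hmono i hi.le 0 i.zero_le) (hmono N le_rfl (i + 1) hi))
    _ = besov p δ f (t 0) (t N) := by
        rw [hsum N le_rfl, besov, restrict_Ioc_eq_restrict_Icc]

theorem sum_rpow_mul_rpow_le {ι : Type*} (s : Finset ι) {θ : ℝ} (h0 : 0 < θ) (h1 : θ < 1)
    {x y : ι → ℝ} (hx : ∀ i ∈ s, 0 ≤ x i) (hy : ∀ i ∈ s, 0 ≤ y i) :
    ∑ i ∈ s, x i ^ (1 - θ) * y i ^ θ ≤ (∑ i ∈ s, x i) ^ (1 - θ) * (∑ i ∈ s, y i) ^ θ := by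
  have h1' : 0 < 1 - θ := by linarith
  have hc : (1 - θ)⁻¹.HolderConjugate θ⁻¹ := by
    rw [Real.holderConjugate_iff]
    exact ⟨(one_lt_inv₀ h1').2 (by linarith), by simp⟩
  have h := Real.inner_le_Lp_mul_Lq_of_nonneg s hc
    (fun i hi => Real.rpow_nonneg (hx i hi) (1 - θ)) (fun i hi => Real.rpow_nonneg (hy i hi) θ)
  rw [Finset.sum_congr rfl fun i hi => Real.rpow_rpow_inv (hx i hi) h1'.ne',
    Finset.sum_congr rfl fun i hi => Real.rpow_rpow_inv (hy i hi) h0.ne'] at h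
  simpa using h

/-- Besov–variation embedding: for `p ≥ 1`, `δ ∈ (0,1)` with `δ − 1/p > 0` and
`q = 1/δ`, there is a constant `C = C(p, δ)` such that for every continuous
`f : [0,1] → ℝ^d` every `q`-variation sum of `f` is at most
`C · B_{δ,p}(f; 0, 1)^{q/p}`. -/
theorem besov_q_variation_bound (p δ : ℝ) (hp : 1 ≤ p) (hδ : δ ∈ Ioo (0 : ℝ) 1)
    (hα : 0 < δ - 1 / p) :
    ∃ C : ℝ, ∀ (d : ℕ) (f : ℝ → EuclideanSpace ℝ (Fin d)),
      ContinuousOn f (Icc 0 1) →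
      ∀ S ∈ varSums (1 / δ) f,
        ENNReal.ofReal S ≤ ENNReal.ofReal C * besov p δ f 0 1 ^ ((1 / δ) / p) := by
  have hp0 : 0 < p := by linarith
  have hδ0 : 0 < δ := hδ.1
  have hδp : 1 < δ * p := (div_lt_iff₀ hp0).1 (sub_pos.1 hα)
  have hr1 : 0 < 1 - (1 / 2 : ℝ) ^ (δ - 1 / p) :=
    sub_pos.2 (Real.rpow_lt_one (by norm_num) (by norm_num) hα)
  set K : ℝ := 2 / (1 - (1 / 2 : ℝ) ^ (δ - 1 / p)) with hK
  have hK0 : 0 < K := by positivity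
  set θ : ℝ := 1 / δ / p with hθ
  have hθ0 : 0 < θ := by positivity
  have hθ1 : θ < 1 := by
    rw [hθ, div_div, div_lt_one (by positivity)]
    exact hδp
  refine ⟨K ^ (1 / δ) * 2 ^ θ, ?_⟩
  rintro d f hf S ⟨N, t, ht0, htN, hlt, rfl⟩
  rcases eq_or_ne (besov p δ f 0 1) ∞ with hB | hB
  · rw [hB, ENNReal.top_rpow_of_pos hθ0, ENNReal.mul_top]
    · exact le_top
    · rw [Ne, ENNReal.ofReal_eq_zero, not_le]
      positivity
  have hsum : ∑ i ∈ Finset.range N, besov p δ f (t i) (t (i + 1)) ≤ besov p δ f 0 1 := by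
    simpa only [ht0, htN] using sum_besov_le (p := p) (δ := δ) f fun i hi => (hlt i hi).le
  have hBi : ∀ i ∈ Finset.range N, besov p δ f (t i) (t (i + 1)) ≠ ∞ :=
    ENNReal.sum_ne_top.1 (ne_top_of_le_ne_top hB hsum)
  have hmono : ∀ i ≤ N, ∀ j ≤ i, t j ≤ t i := by
    intro i hi j hj
    induction i, hj using Nat.le_induction with
    | base => exact le_rfl
    | succ i hij ih => exact (ih (by omega)).trans (hlt i (by omega)).le
  have hterm : ∀ i ∈ Finset.range N, ‖f (t (i + 1)) - f (t i)‖ ^ (1 / δ)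
      ≤ K ^ (1 / δ) * 2 ^ θ *
        ((t (i + 1) - t i) ^ (1 - θ) * (besov p δ f (t i) (t (i + 1))).toReal ^ θ) := by
    intro i hi
    have hiN := Finset.mem_range.1 hi
    have hl : 0 < t (i + 1) - t i := sub_pos.2 (hlt i hiN)
    have hsub : Icc (t i) (t (i + 1)) ⊆ Icc 0 1 := Set.Icc_subset_Icc
      (ht0 ▸ hmono i hiN.le 0 i.zero_le) (htN ▸ hmono N le_rfl (i + 1) hiN)
    have hnn : 0 ≤ (besov p δ f (t i) (t (i + 1))).toReal := ENNReal.toReal_nonneg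
    have h := Real.rpow_le_rpow (norm_nonneg _)
      (norm_sub_le_besov hp hδ0 hα (hlt i hiN) (hf.mono hsub) (hBi i hi))
      (by positivity : 0 ≤ 1 / δ)
    have hexp : 1 / p * (1 / δ) = θ := by rw [hθ]; ring
    have hexp' : (δ * p - 1) * θ = 1 - θ := by rw [hθ]; field_simp
    rw [Real.mul_rpow hK0.le (by positivity), ← Real.rpow_mul (by positivity), hexp,
      Real.mul_rpow (by positivity) hnn, Real.mul_rpow (by norm_num) (by positivity),
      ← Real.rpow_mul hl.le, hexp'] at h
    exact h.trans_eq (by ring)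
  have hSum : ∑ i ∈ Finset.range N, (besov p δ f (t i) (t (i + 1))).toReal
      ≤ (besov p δ f 0 1).toReal := by
    rw [← ENNReal.toReal_sum hBi]
    exact ENNReal.toReal_mono hB hsum
  have hreal : ∑ i ∈ Finset.range N, ‖f (t (i + 1)) - f (t i)‖ ^ (1 / δ)
      ≤ K ^ (1 / δ) * 2 ^ θ * (besov p δ f 0 1).toReal ^ θ := by
    refine (Finset.sum_le_sum hterm).trans ?_
    rw [← Finset.mul_sum]
    gcongr
    refine (sum_rpow_mul_rpow_le _ hθ0 hθ1
      (fun i hi => (sub_pos.2 (hlt i (Finset.mem_range.1 hi))).le)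
      (fun i _ => ENNReal.toReal_nonneg)).trans ?_
    rw [Finset.sum_range_sub, ht0, htN, sub_zero, Real.one_rpow, one_mul]
    exact Real.rpow_le_rpow (Finset.sum_nonneg fun i _ => ENNReal.toReal_nonneg) hSum hθ0.le
  calc ENNReal.ofReal _ ≤ ENNReal.ofReal (K ^ (1 / δ) * 2 ^ θ * (besov p δ f 0 1).toReal ^ θ) :=
        ENNReal.ofReal_le_ofReal hreal
    _ = _ := by
        rw [ENNReal.ofReal_mul (by positivity),
          ← ENNReal.ofReal_rpow_of_nonneg ENNReal.toReal_nonneg hθ0.le, ENNReal.ofReal_toReal hB]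
end

section
/- Let q ≥ 1 and let k : [0,1] → ℝ^d be a continuous function of finite q-variation, i.e. V_q(k) := sup over all finite partitions 0 = t_0 < ⋯ < t_N = 1 of Σ_{i=1}^N |k(t_i) − k(t_{i−1})|^q is finite. For each m ≥ 1 let k(m) denote the m-th dyadic piecewise linear approximation of k, defined by k(m)(t) = k((l−1)/2^m) + 2^m (k(l/2^m) − k((l−1)/2^m)) (t − (l−1)/2^m) for t ∈ [(l−1)/2^m, l/2^m]. Then for every q' > q, k(m) converges to k in q'-variation norm as m → ∞: lim_{m→∞} [ |k(m)(0) − k(0)| + ( sup over all finite partitions 0 = t_0 < ⋯ < t_N = 1 of Σ_{i=1}^N |(k(m) − k)(t_i) − (k(m) − k)(t_{i−1})|^{q'} )^{1/q'} ] = 0. -/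
open Set Finset Filter

/-- The `m`-th dyadic piecewise linear approximation of a path `k : [0,1] → ℝ^d`:
it agrees with `k` at the dyadic points `l/2^m` and is affine in between. -/
noncomputable def dyadicApprox {d : ℕ} (m : ℕ) (k : ℝ → EuclideanSpace ℝ (Fin d))
    (t : ℝ) : EuclideanSpace ℝ (Fin d) :=
  k ((⌊(2 : ℝ) ^ m * t⌋ : ℝ) / 2 ^ m) +
    ((2 : ℝ) ^ m * t - (⌊(2 : ℝ) ^ m * t⌋ : ℝ)) •
      (k (((⌊(2 : ℝ) ^ m * t⌋ : ℝ) + 1) / 2 ^ m) - k ((⌊(2 : ℝ) ^ m * t⌋ : ℝ) / 2 ^ m))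

open MeasureTheory

lemma sum_mem_varSums_of_monotone {q : ℝ} (hq : q ≠ 0) {E : Type*} [NormedAddCommGroup E]
    (f : ℝ → E) (N : ℕ) (u : ℕ → ℝ) (h0 : u 0 = 0) (h1 : u N = 1)
    (hu : ∀ i < N, u i ≤ u (i + 1)) :
    ∑ i ∈ Finset.range N, ‖f (u (i + 1)) - f (u i)‖ ^ q ∈ varSums q f := by
  suffices H : ∃ (M : ℕ) (t : ℕ → ℝ), t 0 = u 0 ∧ t M = u N ∧ (∀ i < M, t i < t (i + 1)) ∧
      ∑ i ∈ Finset.range N, ‖f (u (i + 1)) - f (u i)‖ ^ q =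
        ∑ i ∈ Finset.range M, ‖f (t (i + 1)) - f (t i)‖ ^ q by
    obtain ⟨M, t, ht0, htM, ht, hS⟩ := H
    exact ⟨M, t, ht0.trans h0, htM.trans h1, ht, hS⟩
  clear h0 h1
  induction N with
  | zero => exact ⟨0, u, rfl, rfl, by simp, by simp⟩
  | succ N ih =>
    obtain ⟨M, t, ht0, htM, ht, hS⟩ := ih fun i hi => hu i (by omega)
    rcases (hu N (by omega)).eq_or_lt with h | h
    · refine ⟨M, t, ht0, htM.trans h, ht, ?_⟩
      rw [Finset.sum_range_succ, hS, h]
      simp [Real.zero_rpow hq]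
    · refine ⟨M + 1, fun i => if i ≤ M then t i else u (N + 1), by simpa using ht0, by simp,
        ?_, ?_⟩
      · intro i hi
        rcases (Nat.lt_succ_iff.mp hi).eq_or_lt with rfl | hi'
        · simpa [htM] using h
        · simpa [hi'.le, Nat.succ_le_of_lt hi'] using ht i hi'
      · rw [Finset.sum_range_succ, Finset.sum_range_succ, hS]
        congr 1
        · refine Finset.sum_congr rfl fun i hi => ?_
          have hi' := Finset.mem_range.mp hi
          simp [hi'.le, Nat.succ_le_of_lt hi']
        · simp [htM]

lemma mem_Icc_of_partition {N : ℕ} {t : ℕ → ℝ} (h0 : t 0 = 0) (h1 : t N = 1)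
    (ht : ∀ i < N, t i < t (i + 1)) {i : ℕ} (hi : i ≤ N) : t i ∈ Icc (0 : ℝ) 1 := by
  have hmono : MonotoneOn t (Set.Icc 0 N) :=
    monotoneOn_of_le_succ ordConnected_Icc fun a _ _ ha' => (ht a (by
      have := ha'.2
      simp only [Order.succ_eq_add_one] at this
      omega)).le
  constructor
  · rw [← h0]
    exact hmono ⟨le_rfl, Nat.zero_le _⟩ ⟨Nat.zero_le _, hi⟩ (Nat.zero_le _)
  · rw [← h1]
    exact hmono ⟨Nat.zero_le _, hi⟩ ⟨Nat.zero_le _, le_rfl⟩ hi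

lemma varSums_nonneg {q : ℝ} {E : Type*} [NormedAddCommGroup E] {f : ℝ → E} {S : ℝ}
    (hS : S ∈ varSums q f) : 0 ≤ S := by
  obtain ⟨N, t, -, -, -, rfl⟩ := hS
  exact Finset.sum_nonneg fun i _ => by positivity

lemma varSums_nonempty (q : ℝ) {E : Type*} [NormedAddCommGroup E] (f : ℝ → E) :
    (varSums q f).Nonempty :=
  ⟨_, 1, fun i => i, by simp, by simp, by simp, rfl⟩

/-- Interpolation between the supremum norm and the `q`-variation. -/
lemma varSums_le_of_norm_le {q q' : ℝ} (hq : 0 ≤ q) (hq' : q ≤ q') {E : Type*}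
    [NormedAddCommGroup E] {g : ℝ → E} {ε C : ℝ} (hε : ∀ t ∈ Icc (0 : ℝ) 1, ‖g t‖ ≤ ε)
    (hC : C ∈ upperBounds (varSums q g)) :
    (2 * ε) ^ (q' - q) * C ∈ upperBounds (varSums q' g) := by
  rintro _ ⟨N, t, h0, h1, ht, rfl⟩
  have hε0 : 0 ≤ ε := (norm_nonneg _).trans (hε 0 (by simp))
  have hS := hC ⟨N, t, h0, h1, ht, rfl⟩
  refine le_trans ?_ (mul_le_mul_of_nonneg_left hS (by positivity))
  rw [Finset.mul_sum]
  refine Finset.sum_le_sum fun i hi => ?_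
  have hi' := Finset.mem_range.mp hi
  have h : ‖g (t (i + 1)) - g (t i)‖ ≤ 2 * ε := by
    have ha := hε _ (mem_Icc_of_partition h0 h1 ht (Nat.succ_le_of_lt hi'))
    have hb := hε _ (mem_Icc_of_partition h0 h1 ht hi'.le)
    linarith [norm_sub_le (g (t (i + 1))) (g (t i))]
  calc ‖g (t (i + 1)) - g (t i)‖ ^ q'
      = ‖g (t (i + 1)) - g (t i)‖ ^ (q' - q) * ‖g (t (i + 1)) - g (t i)‖ ^ q := by
        rw [← Real.rpow_add_of_nonneg (norm_nonneg _) (by linarith) hq]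
        congr 1
        ring
    _ ≤ _ := by gcongr

lemma rpow_norm_sub_le {q : ℝ} (hq : 0 ≤ q) {E : Type*} [NormedAddCommGroup E] (a b : E) :
    ‖a - b‖ ^ q ≤ 2 ^ q * (‖a‖ ^ q + ‖b‖ ^ q) := by
  have h : ‖a - b‖ ≤ 2 * max ‖a‖ ‖b‖ := by
    linarith [norm_sub_le a b, le_max_left ‖a‖ ‖b‖, le_max_right ‖a‖ ‖b‖]
  calc ‖a - b‖ ^ q ≤ (2 * max ‖a‖ ‖b‖) ^ q := by gcongr
    _ = 2 ^ q * (max ‖a‖ ‖b‖) ^ q := Real.mul_rpow (by norm_num) (by positivity)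
    _ ≤ _ := by
        gcongr
        have ha : 0 ≤ ‖a‖ ^ q := by positivity
        have hb : 0 ≤ ‖b‖ ^ q := by positivity
        rcases max_choice ‖a‖ ‖b‖ with h | h <;> rw [h] <;> linarith

lemma varSums_sub_le {q : ℝ} (hq : 0 ≤ q) {E : Type*} [NormedAddCommGroup E] {f g : ℝ → E}
    {A B : ℝ} (hA : A ∈ upperBounds (varSums q f)) (hB : B ∈ upperBounds (varSums q g)) :
    2 ^ q * (A + B) ∈ upperBounds (varSums q fun t => f t - g t) := by
  rintro _ ⟨N, t, h0, h1, ht, rfl⟩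
  have hf := hA ⟨N, t, h0, h1, ht, rfl⟩
  have hg := hB ⟨N, t, h0, h1, ht, rfl⟩
  refine le_trans ?_ (mul_le_mul_of_nonneg_left (add_le_add hf hg) (by positivity))
  rw [← Finset.sum_add_distrib, Finset.mul_sum]
  refine Finset.sum_le_sum fun i _ => ?_
  rw [sub_sub_sub_comm]
  exact rpow_norm_sub_le hq _ _

lemma floor_add_eq_of_lt {x η : ℝ} (h0 : 0 ≤ η) (h : η < 1 - Int.fract x) :
    ⌊x + η⌋ = ⌊x⌋ := by
  rw [Int.floor_eq_iff]
  have := Int.floor_add_fract x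
  have := Int.fract_nonneg x
  constructor <;> linarith

lemma floor_add_eq_of_le {x η : ℝ} (h1 : η < 1) (h : 1 - Int.fract x ≤ η) :
    ⌊x + η⌋ = ⌊x⌋ + 1 := by
  rw [Int.floor_eq_iff]
  push_cast
  have := Int.floor_add_fract x
  have := Int.fract_lt_one x
  constructor <;> linarith

lemma floor_add_eq_or {x η : ℝ} (h : η ∈ Ico (0 : ℝ) 1) :
    ⌊x + η⌋ = ⌊x⌋ ∨ ⌊x + η⌋ = ⌊x⌋ + 1 :=
  (lt_or_ge η (1 - Int.fract x)).imp (floor_add_eq_of_lt h.1) (floor_add_eq_of_le h.2)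

lemma integrableOn_floor_add {F : Type*} [NormedAddCommGroup F] (h : ℤ → ℤ → F) (x y : ℝ) :
    IntegrableOn (fun η : ℝ => h ⌊x + η⌋ ⌊y + η⌋) (Ico 0 1) := by
  have hm : Measurable fun η : ℝ => (⌊x + η⌋, ⌊y + η⌋) := by fun_prop
  have hs : StronglyMeasurable fun η : ℝ => h ⌊x + η⌋ ⌊y + η⌋ :=
    (StronglyMeasurable.of_discrete (f := fun p : ℤ × ℤ => h p.1 p.2)).comp_measurable hm
  refine IntegrableOn.of_bound (by simp) hs.aestronglyMeasurable
    (‖h ⌊x⌋ ⌊y⌋‖ + ‖h ⌊x⌋ (⌊y⌋ + 1)‖ + ‖h (⌊x⌋ + 1) ⌊y⌋‖ + ‖h (⌊x⌋ + 1) (⌊y⌋ + 1)‖) ?_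
  filter_upwards [ae_restrict_mem measurableSet_Ico] with η hη
  have h1 := norm_nonneg (h ⌊x⌋ ⌊y⌋)
  have h2 := norm_nonneg (h ⌊x⌋ (⌊y⌋ + 1))
  have h3 := norm_nonneg (h (⌊x⌋ + 1) ⌊y⌋)
  have h4 := norm_nonneg (h (⌊x⌋ + 1) (⌊y⌋ + 1))
  rcases floor_add_eq_or (x := x) hη with hx | hx <;>
    rcases floor_add_eq_or (x := y) hη with hy | hy <;> rw [hx, hy] <;> linarith

lemma setIntegral_floor_add {F : Type*} [NormedAddCommGroup F] [NormedSpace ℝ F]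
    [CompleteSpace F] (h : ℤ → F) (x : ℝ) :
    ∫ η in Ico (0 : ℝ) 1, h ⌊x + η⌋ = h ⌊x⌋ + Int.fract x • (h (⌊x⌋ + 1) - h ⌊x⌋) := by
  have hr0 := Int.fract_nonneg x
  have hr1 := Int.fract_lt_one x
  have hi : IntegrableOn (fun η : ℝ => h ⌊x + η⌋) (Set.Ico 0 1) :=
    integrableOn_floor_add (fun a _ => h a) x x
  have hunion : Set.Ico 0 (1 - Int.fract x) ∪ Set.Ico (1 - Int.fract x) 1 = Set.Ico 0 1 :=
    Set.Ico_union_Ico_eq_Ico (by linarith) (by linarith)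
  rw [← hunion] at hi ⊢
  rw [setIntegral_union (Ico_disjoint_Ico_same) measurableSet_Ico hi.left_of_union
      hi.right_of_union,
    setIntegral_congr_fun (g := fun _ => h ⌊x⌋) measurableSet_Ico
      fun η hη => congrArg h (floor_add_eq_of_lt hη.1 hη.2),
    setIntegral_congr_fun (g := fun _ => h (⌊x⌋ + 1)) measurableSet_Ico
      fun η hη => congrArg h (floor_add_eq_of_le hη.2 hη.1)]
  simp only [setIntegral_const, Real.volume_real_Ico]
  rw [max_eq_left (by linarith), max_eq_left (by linarith), smul_sub, sub_zero, sub_smul, one_smul,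
    sub_sub_cancel]
  abel

/-- The dyadic approximation averages `k` over the monotone roundings
`t ↦ ⌊2 ^ m * t + η⌋ / 2 ^ m` of `[0,1]` to the dyadic grid. -/
lemma dyadicApprox_eq_integral {d : ℕ} (m : ℕ) (k : ℝ → EuclideanSpace ℝ (Fin d)) (t : ℝ) :
    dyadicApprox m k t = ∫ η in Ico (0 : ℝ) 1, k (⌊2 ^ m * t + η⌋ / 2 ^ m) := by
  rw [setIntegral_floor_add (fun a : ℤ => k (a / 2 ^ m))]
  simp only [dyadicApprox, Int.self_sub_floor, Int.cast_add, Int.cast_one]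

lemma rpow_norm_setIntegral_le {q : ℝ} (hq : 1 ≤ q) {F : Type*} [NormedAddCommGroup F]
    [NormedSpace ℝ F] {f : ℝ → F} (hf : IntegrableOn f (Ico 0 1))
    (hf' : IntegrableOn (fun η => ‖f η‖ ^ q) (Ico 0 1)) :
    ‖∫ η in Ico (0 : ℝ) 1, f η‖ ^ q ≤ ∫ η in Ico (0 : ℝ) 1, ‖f η‖ ^ q := by
  have : IsProbabilityMeasure (volume.restrict (Ico (0 : ℝ) 1)) := ⟨by simp⟩
  calc ‖∫ η in Ico (0 : ℝ) 1, f η‖ ^ q ≤ (∫ η in Ico (0 : ℝ) 1, ‖f η‖) ^ q := by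
        gcongr
        exact norm_integral_le_integral_norm _
    _ ≤ _ := (convexOn_rpow hq).map_integral_le
        (Real.continuous_rpow_const (by linarith)).continuousOn isClosed_Ici
        (Eventually.of_forall fun η => norm_nonneg (f η)) hf.norm hf'

/-- Dyadic approximation does not increase the `q`-variation. -/
lemma upperBounds_varSums_dyadicApprox {q : ℝ} (hq : 1 ≤ q) {d : ℕ} (m : ℕ)
    {k : ℝ → EuclideanSpace ℝ (Fin d)} {C : ℝ} (hC : C ∈ upperBounds (varSums q k)) :
    C ∈ upperBounds (varSums q (dyadicApprox m k)) := by
  rintro _ ⟨N, t, h0, h1, ht, rfl⟩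
  have hint (i j : ℕ) := integrableOn_floor_add
    (fun a b : ℤ => ‖k (a / 2 ^ m) - k (b / 2 ^ m)‖ ^ q) (2 ^ m * t i) (2 ^ m * t j)
  have hk (i : ℕ) := integrableOn_floor_add
    (fun a _ : ℤ => k (a / 2 ^ m)) (2 ^ m * t i) 0
  calc ∑ i ∈ Finset.range N, ‖dyadicApprox m k (t (i + 1)) - dyadicApprox m k (t i)‖ ^ q
      ≤ ∑ i ∈ Finset.range N, ∫ η in Ico (0 : ℝ) 1,
          ‖k (⌊2 ^ m * t (i + 1) + η⌋ / 2 ^ m) - k (⌊2 ^ m * t i + η⌋ / 2 ^ m)‖ ^ q := by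
        refine Finset.sum_le_sum fun i _ => ?_
        rw [dyadicApprox_eq_integral, dyadicApprox_eq_integral, ← integral_sub (hk _) (hk _)]
        exact rpow_norm_setIntegral_le hq ((hk _).sub (hk _)) (hint _ _)
    _ = ∫ η in Ico (0 : ℝ) 1, ∑ i ∈ Finset.range N,
          ‖k (⌊2 ^ m * t (i + 1) + η⌋ / 2 ^ m) - k (⌊2 ^ m * t i + η⌋ / 2 ^ m)‖ ^ q :=
        (integral_finsetSum _ fun i _ => hint _ _).symm
    _ ≤ ∫ η in Ico (0 : ℝ) 1, C := by
        refine setIntegral_mono_on (integrable_finsetSum _ fun i _ => hint _ _)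
          (integrableOn_const (by simp)) measurableSet_Ico fun η hη => hC ?_
        have hη0 : ⌊η⌋ = 0 := Int.floor_eq_zero_iff.mpr hη
        refine sum_mem_varSums_of_monotone (by linarith) k N
          (fun i => ⌊2 ^ m * t i + η⌋ / 2 ^ m) (by simp [h0, hη0]) ?_ fun i hi => ?_
        · have : ⌊(2 : ℝ) ^ m + η⌋ = 2 ^ m := by
            rw [Int.floor_eq_iff]
            push_cast
            exact ⟨by linarith [hη.1], by linarith [hη.2]⟩
          simp [h1, this]
        · have := (ht i hi).le
          gcongr
    _ = C := by simp

lemma dyadic_round_mem_Icc {m : ℕ} {t η : ℝ} (ht : t ∈ Icc (0 : ℝ) 1) (hη : η ∈ Ico (0 : ℝ) 1) :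
    (⌊2 ^ m * t + η⌋ / 2 ^ m : ℝ) ∈ Icc (0 : ℝ) 1 := by
  have h2 : (0 : ℝ) < 2 ^ m := by positivity
  constructor
  · have : 0 ≤ ⌊2 ^ m * t + η⌋ :=
      Int.floor_nonneg.mpr (add_nonneg (mul_nonneg h2.le ht.1) hη.1)
    have : (0 : ℝ) ≤ ⌊2 ^ m * t + η⌋ := by exact_mod_cast this
    positivity
  · rw [div_le_one h2]
    have : ⌊2 ^ m * t + η⌋ < 2 ^ m + 1 := by
      rw [Int.floor_lt]
      push_cast
      nlinarith [ht.2, hη.2]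
    exact_mod_cast Int.lt_add_one_iff.mp this

lemma dist_dyadic_round_le {m : ℕ} {t η : ℝ} (hη : η ∈ Ico (0 : ℝ) 1) :
    dist (⌊2 ^ m * t + η⌋ / 2 ^ m : ℝ) t ≤ (1 / 2) ^ m := by
  have h2 : (0 : ℝ) < 2 ^ m := by positivity
  have ha := Int.floor_le (2 ^ m * t + η)
  have hb := Int.lt_floor_add_one (2 ^ m * t + η)
  have h : (⌊2 ^ m * t + η⌋ / 2 ^ m : ℝ) - t = (⌊2 ^ m * t + η⌋ - 2 ^ m * t) / 2 ^ m := by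
    field_simp
  rw [Real.dist_eq, h, abs_div, abs_of_pos h2, one_div_pow]
  gcongr
  rw [abs_le]
  constructor <;> linarith [hη.1, hη.2]

lemma norm_dyadicApprox_sub_le {d : ℕ} {m : ℕ} {k : ℝ → EuclideanSpace ℝ (Fin d)} {t ε : ℝ}
    (h : ∀ η ∈ Ico (0 : ℝ) 1, ‖k (⌊2 ^ m * t + η⌋ / 2 ^ m) - k t‖ ≤ ε) :
    ‖dyadicApprox m k t - k t‖ ≤ ε := by
  have hk := integrableOn_floor_add (fun a _ : ℤ => k (a / 2 ^ m)) (2 ^ m * t) 0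
  have hc : ∫ _ in Ico (0 : ℝ) 1, k t = k t := by simp
  have hi : IntegrableOn (fun _ => k t) (Ico (0 : ℝ) 1) := integrableOn_const (by simp)
  rw [dyadicApprox_eq_integral, ← hc, ← integral_sub hk hi]
  simpa using norm_setIntegral_le_of_norm_le_const (μ := volume) measure_Ico_lt_top h

/-- If `k : [0,1] → ℝ^d` is continuous and of finite `q`-variation, then for every
`q' > q` the dyadic piecewise linear approximations `k(m)` converge to `k` in
`q'`-variation norm as `m → ∞`. -/
theorem dyadic_approx_tendsto (q q' : ℝ) (hq : 1 ≤ q) (hq' : q < q')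
    (d : ℕ) (k : ℝ → EuclideanSpace ℝ (Fin d)) (hk : ContinuousOn k (Icc 0 1))
    (hfin : BddAbove (varSums q k)) :
    ∃ V : ℕ → ℝ,
      (∀ m : ℕ, IsLUB (varSums q' (fun t => dyadicApprox m k t - k t)) (V m)) ∧
      Tendsto (fun m : ℕ => ‖dyadicApprox m k 0 - k 0‖ + V m ^ (1 / q')) atTop (nhds 0) := by
  obtain ⟨C, hC⟩ := hfin
  have key {m : ℕ} {ε : ℝ} (hε : ∀ t ∈ Icc (0 : ℝ) 1, ‖dyadicApprox m k t - k t‖ ≤ ε) :=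
    varSums_le_of_norm_le (by linarith) hq'.le hε
      (varSums_sub_le (by linarith) (upperBounds_varSums_dyadicApprox hq m hC) hC)
  have hbdd (m : ℕ) : BddAbove (varSums q' fun t => dyadicApprox m k t - k t) := by
    obtain ⟨B, hB⟩ := isCompact_Icc.exists_bound_of_continuousOn hk
    refine ⟨_, key (ε := B + B) fun t ht => norm_dyadicApprox_sub_le fun η hη => ?_⟩
    exact (norm_sub_le _ _).trans (add_le_add (hB _ (dyadic_round_mem_Icc ht hη)) (hB t ht))
  have hlub (m : ℕ) := isLUB_csSup (varSums_nonempty q' fun t => dyadicApprox m k t - k t) (hbdd m)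
  refine ⟨_, hlub, ?_⟩
  have hV : Tendsto (fun m => sSup (varSums q' fun t => dyadicApprox m k t - k t)) atTop
      (nhds 0) := by
    have hlim : Tendsto (fun ε : ℝ => (2 * ε) ^ (q' - q) * (2 ^ q * (C + C)))
        (nhdsWithin 0 (Ioi 0)) (nhds 0) := by
      have hc : Continuous fun ε : ℝ => (2 * ε) ^ (q' - q) * (2 ^ q * (C + C)) :=
        ((Real.continuous_rpow_const (by linarith)).comp (continuous_const_mul 2)).mul
          continuous_const
      have := hc.tendsto 0
      rw [mul_zero, Real.zero_rpow (by linarith), zero_mul] at this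
      exact this.mono_left nhdsWithin_le_nhds
    rw [Metric.tendsto_atTop]
    intro δ hδ
    obtain ⟨ε, hεδ, hε⟩ :=
      ((hlim.eventually (gt_mem_nhds hδ)).and self_mem_nhdsWithin).exists
    obtain ⟨r, hr, hkr⟩ := Metric.uniformContinuousOn_iff.mp
      (isCompact_Icc.uniformContinuousOn_of_continuous hk) ε hε
    obtain ⟨M, hM⟩ := exists_pow_lt_of_lt_one hr (show (1 / 2 : ℝ) < 1 by norm_num)
    refine ⟨M, fun m hm => ?_⟩
    have hmr : (1 / 2 : ℝ) ^ m < r :=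
      (pow_le_pow_of_le_one (by norm_num) (by norm_num) hm).trans_lt hM
    obtain ⟨S, hS⟩ := varSums_nonempty q' fun t => dyadicApprox m k t - k t
    rw [Real.dist_0_eq_abs, abs_of_nonneg ((varSums_nonneg hS).trans ((hlub m).1 hS))]
    refine lt_of_le_of_lt ((hlub m).2 (key fun t ht => ?_)) hεδ
    refine norm_dyadicApprox_sub_le fun η hη => ?_
    rw [← dist_eq_norm]
    exact (hkr _ (dyadic_round_mem_Icc ht hη) _ ht ((dist_dyadic_round_le hη).trans_lt hmr)).le
  have hq0 : 0 < 1 / q' := one_div_pos.mpr (by linarith)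
  have h0 (m : ℕ) : dyadicApprox m k 0 = k 0 := by simp [dyadicApprox]
  have := hV.rpow_const (Or.inr hq0.le)
  rw [Real.zero_rpow hq0.ne'] at this
  simpa only [h0, sub_self, norm_zero, zero_add] using this
end
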